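/- Let T be an expanding Markov map with repeller Λ. Then the Hausdorff dimension of the repeller satisfies dim Λ = inf{s : P(−sψ) ≤ 0}, where ψ(x) := log|T'(x)|. -/

import Mathlib

open Set Filter Topology

/-- An expanding Markov map with countably many inverse branches: a countable family
`{V i}` of pairwise disjoint subintervals of `[0,1]` with nonempty interior, and a map `T`
(given here as a global function `ℝ → ℝ`, only its behaviour on `⋃ i, V i` matters) which is
`C¹` on each `V i` with derivative `T'`, maps the interior of each `V i` onto `(0,1)`, is
uniformly expanding, and has tempered distortion of the derivative. -/
structure ExpandingMarkovMap (A : Type) : Type where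
  countable : Countable A
  nontriv : ∃ i j : A, i ≠ j
  V : A → Set ℝ
  T : ℝ → ℝ
  T' : ℝ → ℝ
  V_subset : ∀ i, V i ⊆ Icc (0:ℝ) 1
  V_ordConnected : ∀ i, (V i).OrdConnected
  V_interior_nonempty : ∀ i, (interior (V i)).Nonempty
  V_disjoint : Pairwise (Function.onFun Disjoint V)
  T_mapsTo : ∀ i, MapsTo T (V i) (Icc (0:ℝ) 1)
  T_C1 : ∀ i, ContDiffOn ℝ 1 T (V i)
  T_hasDeriv : ∀ i, ∀ x ∈ V i, HasDerivWithinAt T (T' x) (V i) x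
  T_maps_interior : ∀ i, T '' interior (V i) = Ioo (0:ℝ) 1
  expanding : ∃ ξ > (1:ℝ), ∃ N : ℕ, ∀ n, N ≤ n → ∀ ω : Fin n → A, ∀ x : ℝ,
    (∀ ν : Fin n, T^[(ν : ℕ)] x ∈ V (ω ν)) →
    ξ ^ n < ∏ l ∈ Finset.range n, |T' (T^[l] x)|
  distortion : ∃ ρ : ℕ → ℝ, Tendsto ρ atTop (𝓝 0) ∧
    ∀ n : ℕ, ∀ ω : Fin n → A, ∀ x y : ℝ,
      (∀ ν : Fin n, T^[(ν : ℕ)] x ∈ V (ω ν)) → (∀ ν : Fin n, T^[(ν : ℕ)] y ∈ V (ω ν)) →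
      Real.exp (-(n : ℝ) * ρ n) ≤
          (∏ l ∈ Finset.range n, |T' (T^[l] x)|) / (∏ l ∈ Finset.range n, |T' (T^[l] y)|) ∧
        (∏ l ∈ Finset.range n, |T' (T^[l] x)|) / (∏ l ∈ Finset.range n, |T' (T^[l] y)|) ≤
          Real.exp ((n : ℝ) * ρ n)

namespace ExpandingMarkovMap

variable {A : Type} (M : ExpandingMarkovMap A)

/-- The cylinder `V_ω = ⋂_{ν<n} T^{-ν}(V_{ω_ν})` associated to a word `ω ∈ A^n`. -/
def cylinder {n : ℕ} (ω : Fin n → A) : Set ℝ :=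
  {x | ∀ ν : Fin n, M.T^[(ν : ℕ)] x ∈ M.V (ω ν)}

/-- The repeller `Λ`: the set of points all of whose iterates are well defined. -/
def repeller : Set ℝ := {x | ∀ n : ℕ, M.T^[n] x ∈ ⋃ i, M.V i}

/-- The Birkhoff sum `S_n(f)(x) = ∑_{l<n} f(T^l x)`. -/
def birkhoff (f : ℝ → ℝ) (n : ℕ) (x : ℝ) : ℝ := ∑ l ∈ Finset.range n, f (M.T^[l] x)

/-- `S_n(f)(ω) = sup { S_n(f)(x) : x ∈ V_ω }` (`f` being a potential on `Λ`). -/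
noncomputable def birkhoffSup (f : ℝ → ℝ) {n : ℕ} (ω : Fin n → A) : ℝ :=
  sSup {v | ∃ x ∈ M.cylinder ω ∩ M.repeller, v = M.birkhoff f n x}

/-- The set of values `|f x - f y|` over pairs `x, y` in a common `n`-cylinder. -/
def varSet (f : ℝ → ℝ) (n : ℕ) : Set ℝ :=
  {d | ∃ ω : Fin n → A, ∃ x ∈ M.cylinder ω ∩ M.repeller, ∃ y ∈ M.cylinder ω ∩ M.repeller,
    d = |f x - f y|}

/-- The `n`-th level variation `var_n(f)`. -/
noncomputable def var (f : ℝ → ℝ) (n : ℕ) : ℝ := sSup (M.varSet f n)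

/-- The tempered distortion condition for a potential on `Λ`:
`var_1(f) < ∞` and `n⁻¹ var_n(S_n(f)) → 0`. -/
def Tempered (f : ℝ → ℝ) : Prop :=
  BddAbove (M.varSet f 1) ∧
    Tendsto (fun n : ℕ => M.var (M.birkhoff f n) n / (n : ℝ)) atTop (𝓝 0)

/-- The topological pressure `P(f) = lim_n n⁻¹ log ∑_{ω ∈ Aⁿ} exp S_n(f)(ω)`
(realised as a `limsup` in `EReal`; the limit exists for tempered potentials). -/
noncomputable def pressure (f : ℝ → ℝ) : EReal :=
  limsup (fun n : ℕ =>
    ((1 / (n : ℝ) : ℝ) : EReal) *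
      ENNReal.log (∑' ω : Fin n → A, ENNReal.ofReal (Real.exp (M.birkhoffSup f ω)))) atTop

/-- The potential `ψ = log |T'|`. -/
noncomputable def psi : ℝ → ℝ := fun x => Real.log |M.T' x|

/-- `s(φ) = inf { s : P(-s(ψ+φ)) ≤ 0 }`. -/
noncomputable def sdim (φ : ℝ → ℝ) : ℝ :=
  sInf {s : ℝ | M.pressure (fun x => -s * (M.psi x + φ x)) ≤ 0}

/-- The shrinking target set `D_y(φ)`. -/
def shrinkingTarget (y : ℝ) (φ : ℝ → ℝ) : Set ℝ :=
  ⋂ m : ℕ, ⋃ n : ℕ, ⋃ _ : m ≤ n,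
    {x | x ∈ M.repeller ∧ |M.T^[n] x - y| < Real.exp (-(M.birkhoff φ n x))}

/-- The shrinking target set `S_y(Φ)` for a sequence of radii `Φ`. -/
def shrinkingTargetSeq (y : ℝ) (Φ : ℕ → ℝ) : Set ℝ :=
  ⋂ m : ℕ, ⋃ n : ℕ, ⋃ _ : m ≤ n, {x | x ∈ M.repeller ∧ |M.T^[n] x - y| < Φ n}

/-- `g` is the iterated function system associated to `M`: `g i` is the inverse branch of
`T` on `V i`, a `C¹` map of `[0,1]` into `closure (V i)` with `g i (T x) = x` on `V i`. -/
def IsIFS (g : A → ℝ → ℝ) : Prop :=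
  ∀ i, ContDiffOn ℝ 1 (g i) (Icc (0:ℝ) 1) ∧ MapsTo (g i) (Icc (0:ℝ) 1) (closure (M.V i)) ∧
    ∀ x ∈ M.V i, g i (M.T x) = x

end ExpandingMarkovMap

/-- The composition `φ_τ = φ_{τ_1} ∘ ⋯ ∘ φ_{τ_n}` of the maps of an IFS along a word `τ`. -/
def ifsWord {A : Type} (g : A → ℝ → ℝ) {n : ℕ} (τ : Fin n → A) : ℝ → ℝ :=
  (List.ofFn fun ν : Fin n => g (τ ν)).foldr (· ∘ ·) id

/-- `C(y,n,r)`: the collection of cylinder sets `φ_τ([0,1])`, `τ ∈ Aⁿ`, contained in `B(y,r)`. -/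
def cylinderFamily {A : Type} (g : A → ℝ → ℝ) (y : ℝ) (n : ℕ) (r : ℝ) : Set (Set ℝ) :=
  {S | ∃ τ : Fin n → A, S = ifsWord g τ '' Icc (0:ℝ) 1 ∧ S ⊆ Metric.ball y r}

/-- Positive upper cylinder density of the IFS `g` at `y`. -/
def HasPUCD {A : Type} (g : A → ℝ → ℝ) (y : ℝ) : Prop :=
  ∃ lam : ℝ → ℕ,
    Tendsto lam (𝓝[>] (0:ℝ)) atTop ∧
    limsup (fun r : ℝ => Real.log r / (lam r : ℝ)) (𝓝[>] (0:ℝ)) < 0 ∧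
    0 < limsup (fun r : ℝ =>
        (ENNReal.ofReal r)⁻¹ * ∑' S : cylinderFamily g y (lam r) r, EMetric.diam (S : Set ℝ))
      (𝓝[>] (0:ℝ))

open MeasureTheory
open scoped ENNReal NNReal

section CodingMap

variable {F X : Type*}

/-- The coding map of an iterated function system consisting of finitely many contractions. -/
theorem exists_codingMap [Finite F] [TopologicalSpace F] [DiscreteTopology F]
    [MetricSpace X] [CompleteSpace X] [Nonempty X] (g : F → X → X) {r : ℝ≥0} (hr : r < 1)
    (hg : ∀ i, LipschitzWith r (g i)) :
    ∃ π : C(ℕ → F, X), ∀ σ, π σ = g (σ 0) (π fun k => σ (k + 1)) := by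
  have hgc : Continuous fun p : F × X => g p.1 p.2 :=
    continuous_prod_of_discrete_left.mpr fun i => (hg i).continuous
  let Φ : C(ℕ → F, X) → C(ℕ → F, X) := fun f =>
    ⟨fun σ => g (σ 0) (f fun k => σ (k + 1)), hgc.comp (by fun_prop : Continuous
      fun σ : ℕ → F => (σ 0, f fun k => σ (k + 1)))⟩
  have hΦ : ContractingWith r Φ := by
    refine ⟨hr, LipschitzWith.of_dist_le_mul fun f h => ?_⟩
    rw [ContinuousMap.dist_le (by positivity)]
    intro σ
    refine ((hg (σ 0)).dist_le_mul _ _).trans ?_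
    gcongr
    exact ContinuousMap.dist_apply_le_dist _
  have : Nonempty C(ℕ → F, X) := ⟨ContinuousMap.const _ (Classical.arbitrary X)⟩
  exact ⟨ContractingWith.fixedPoint Φ hΦ, fun σ =>
    (DFunLike.congr_fun hΦ.fixedPoint_isFixedPt σ).symm⟩

/-- Points whose codes first differ at position `k` are separated by the product of the lower
contraction ratios along the common prefix. -/
theorem prod_mul_le_dist_codingMap [MetricSpace X] {g : F → X → X} {c : F → ℝ} {θ : ℝ}
    (hc0 : ∀ i, 0 < c i) (hc : ∀ i x y, c i * dist x y ≤ dist (g i x) (g i y))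
    (hsep : ∀ i j, i ≠ j → ∀ x y, θ ≤ dist (g i x) (g j y))
    {π : (ℕ → F) → X} (hπ : ∀ σ, π σ = g (σ 0) (π fun k => σ (k + 1))) (k : ℕ) :
    ∀ σ τ : ℕ → F, (∀ l < k, τ l = σ l) → τ k ≠ σ k →
      (∏ l ∈ Finset.range k, c (σ l)) * θ ≤ dist (π σ) (π τ) := by
  induction k with
  | zero =>
    intro σ τ _ hne
    rw [hπ σ, hπ τ]
    simpa using hsep _ _ hne.symm _ _
  | succ k ih =>
    intro σ τ heq hne
    have h := ih (fun k => σ (k + 1)) (fun k => τ (k + 1)) (fun l hl => heq _ (by omega)) hne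
    rw [hπ σ, hπ τ, heq 0 (by omega), Finset.prod_range_succ', mul_right_comm, mul_comm]
    exact (mul_le_mul_of_nonneg_left h (hc0 _).le).trans (hc _ _ _)

/-- A Bernoulli measure on `ℕ → F` whose cylinders have mass at most `∏ c ^ s`. -/
theorem exists_measure_cylinder_le [Fintype F] [MeasurableSpace F] [MeasurableSingletonClass F]
    (q : F → ℝ≥0) (hq : 1 ≤ ∑ i, q i) :
    ∃ μ : Measure (ℕ → F), IsProbabilityMeasure μ ∧ ∀ (σ : ℕ → F) (k : ℕ),
      μ {τ | ∀ l < k, τ l = σ l} ≤ ∏ l ∈ Finset.range k, (q (σ l) : ℝ≥0∞) := by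
  have h1 : (1 : ℝ≥0∞) ≤ ∑ i, (q i : ℝ≥0∞) := by exact_mod_cast hq
  have ht : tsum (fun i => (q i : ℝ≥0∞)) = ∑ i, (q i : ℝ≥0∞) := tsum_fintype _
  let p : PMF F := PMF.normalize (fun i => (q i : ℝ≥0∞))
    (by rw [ht]; exact (zero_lt_one.trans_le h1).ne')
    (by rw [ht]; exact ENNReal.sum_ne_top.2 fun i _ => ENNReal.coe_ne_top)
  refine ⟨Measure.infinitePi fun _ => p.toMeasure, inferInstance, fun σ k => ?_⟩
  have hset : {τ : ℕ → F | ∀ l < k, τ l = σ l} =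
      Set.pi (Finset.range k : Set ℕ) fun l => {σ l} := by
    ext τ; simp
  rw [hset, Measure.infinitePi_pi _ fun _ _ => measurableSet_singleton _]
  refine Finset.prod_le_prod' fun l _ => ?_
  rw [PMF.toMeasure_apply_singleton _ _ (measurableSet_singleton _), PMF.normalize_apply, ht]
  exact mul_le_of_le_one_right' (ENNReal.inv_le_one.2 h1)

/-- Moran-type lower bound for the dimension of the limit set of a finite iterated function system
with separated images, in terms of lower contraction ratios. -/
theorem le_dimH_range_codingMap [Fintype F] [TopologicalSpace F] [DiscreteTopology F]
    [MetricSpace X] {g : F → X → X} {c : F → ℝ} {r θ : ℝ} (hr : r < 1) (hθ : 0 < θ)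
    (hc0 : ∀ i, 0 < c i) (hcr : ∀ i, c i ≤ r)
    (hc : ∀ i x y, c i * dist x y ≤ dist (g i x) (g i y))
    (hsep : ∀ i j, i ≠ j → ∀ x y, θ ≤ dist (g i x) (g j y))
    (π : C(ℕ → F, X)) (hπ : ∀ σ, π σ = g (σ 0) (π fun k => σ (k + 1)))
    {s : ℝ≥0} (hs : 1 ≤ ∑ i, c i ^ (s : ℝ)) : (s : ℝ≥0∞) ≤ dimH (Set.range π) := by
  rcases eq_or_ne s 0 with rfl | hs0
  · simp
  have hspos : (0 : ℝ) < s := NNReal.coe_pos.2 (pos_iff_ne_zero.2 hs0)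
  borelize X
  borelize F
  obtain ⟨μ, hμ, hcyl⟩ := exists_measure_cylinder_le
    (fun i => (c i ^ (s : ℝ)).toNNReal) (by
      rw [← Real.toNNReal_sum_of_nonneg fun i _ => (Real.rpow_nonneg (hc0 i).le _)]
      simpa using hs)
  have hprod (σ : ℕ → F) (k : ℕ) :
      ∏ l ∈ Finset.range k, (((c (σ l) ^ (s : ℝ)).toNNReal : ℝ≥0) : ℝ≥0∞) =
        ENNReal.ofReal (∏ l ∈ Finset.range k, c (σ l)) ^ (s : ℝ) := by
    rw [ENNReal.ofReal_prod_of_nonneg fun l _ => (hc0 _).le,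
      ← ENNReal.prod_rpow_of_nonneg s.coe_nonneg]
    exact Finset.prod_congr rfl fun l _ => (ENNReal.ofReal_rpow_of_pos (hc0 _)).symm
  have key (U : Set X) : ENNReal.ofReal θ ^ (s : ℝ) * μ (π ⁻¹' U) ≤ Metric.ediam U ^ (s : ℝ) := by
    rcases (π ⁻¹' U).eq_empty_or_nonempty with h0 | ⟨σ, hσ⟩
    · simp [h0]
    by_cases hall : ∃ k, ∃ τ ∈ π ⁻¹' U, τ k ≠ σ k
    · classical
      obtain ⟨τ, hτ, hne⟩ := Nat.find_spec hall
      set k := Nat.find hall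
      have hagree : ∀ l < k, ∀ τ ∈ π ⁻¹' U, τ l = σ l := fun l hl τ hτ => by
        by_contra h
        exact Nat.find_min hall hl ⟨τ, hτ, h⟩
      have hmeas : μ (π ⁻¹' U) ≤ ENNReal.ofReal (∏ l ∈ Finset.range k, c (σ l)) ^ (s : ℝ) :=
        (measure_mono fun τ hτ l hl => hagree l hl τ hτ).trans
          ((hcyl σ k).trans_eq (hprod σ k))
      have hdist := prod_mul_le_dist_codingMap hc0 hc hsep hπ k σ τ
        (fun l hl => hagree l hl τ hτ) hne
      calc ENNReal.ofReal θ ^ (s : ℝ) * μ (π ⁻¹' U)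
          ≤ ENNReal.ofReal θ ^ (s : ℝ) *
            ENNReal.ofReal (∏ l ∈ Finset.range k, c (σ l)) ^ (s : ℝ) := by gcongr
        _ = ENNReal.ofReal ((∏ l ∈ Finset.range k, c (σ l)) * θ) ^ (s : ℝ) := by
            rw [← ENNReal.mul_rpow_of_nonneg _ _ s.coe_nonneg, ← ENNReal.ofReal_mul hθ.le, mul_comm]
        _ ≤ Metric.ediam U ^ (s : ℝ) := by
            gcongr
            refine (ENNReal.ofReal_le_ofReal hdist).trans ?_
            rw [← edist_dist]
            exact Metric.edist_le_ediam_of_mem hσ hτ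
    · push Not at hall
      have hr0 : 0 ≤ r := (hc0 (σ 0)).le.trans (hcr _)
      have hle (k : ℕ) : μ (π ⁻¹' U) ≤ (ENNReal.ofReal r ^ (s : ℝ)) ^ k := by
        refine (measure_mono (t := {τ | ∀ l < k, τ l = σ l}) fun τ hτ l _ => hall l τ hτ).trans
          ((hcyl σ k).trans ((hprod σ k).trans_le ?_))
        rw [← ENNReal.rpow_natCast, ← ENNReal.rpow_mul, mul_comm, ENNReal.rpow_mul,
          ENNReal.rpow_natCast, ← ENNReal.ofReal_pow hr0]
        gcongr
        exact (Finset.prod_le_prod (fun l _ => (hc0 _).le) fun l _ => hcr _).trans_eq (by simp)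
      have hlim := ENNReal.tendsto_pow_atTop_nhds_zero_of_lt_one
        (ENNReal.rpow_lt_one (ENNReal.ofReal_lt_one.2 hr) hspos)
      have : μ (π ⁻¹' U) = 0 := le_antisymm (ge_of_tendsto' hlim hle) bot_le
      simp [this]
  have hθs : ENNReal.ofReal θ ^ (s : ℝ) ≠ 0 := by
    simp [hθ]
  have hle : ENNReal.ofReal θ ^ (s : ℝ) • μ.map π ≤ μH[(s : ℝ)] := by
    refine Measure.le_hausdorffMeasure _ _ 1 one_pos fun U _ => ?_
    rw [← Metric.ediam_closure U]
    refine (measure_mono subset_closure).trans ?_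
    rw [Measure.smul_apply, Measure.map_apply π.continuous.measurable
      isClosed_closure.measurableSet, smul_eq_mul]
    exact key _
  refine le_dimH_of_hausdorffMeasure_ne_zero (ne_of_gt ?_)
  refine lt_of_lt_of_le ?_ (hle (Set.range π))
  rw [Measure.smul_apply, smul_eq_mul]
  refine ENNReal.mul_pos hθs (ne_of_gt ?_)
  refine lt_of_lt_of_le ?_ (Measure.le_map_apply π.continuous.measurable.aemeasurable _)
  simp

end CodingMap

namespace ExpandingMarkovMap

section Cylinders

variable {A : Type} (M : ExpandingMarkovMap A)

/-- The absolute value of the derivative of `T^n`. -/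
noncomputable def derivProd (n : ℕ) (x : ℝ) : ℝ := ∏ l ∈ Finset.range n, |M.T' (M.T^[l] x)|

variable {M}

theorem mem_cylinder_succ {n : ℕ} {ω : Fin (n + 1) → A} {x : ℝ} :
    x ∈ M.cylinder ω ↔
      x ∈ M.cylinder (fun i : Fin n => ω i.castSucc) ∧ M.T^[n] x ∈ M.V (ω (Fin.last n)) := by
  simp [cylinder, Fin.forall_fin_succ']

theorem T'_ne_zero {i : A} {x : ℝ} (hx : x ∈ M.V i) : M.T' x ≠ 0 := by
  obtain ⟨ρ, -, h⟩ := M.distortion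
  intro h0
  have h1 := (h 1 (fun _ => i) x x (by simpa using hx) (by simpa using hx)).1
  simp only [Finset.range_one, Finset.prod_singleton, Function.iterate_zero, id, h0, abs_zero,
    div_zero] at h1
  exact absurd h1 (not_le.2 (Real.exp_pos _))

theorem T'_iterate_ne_zero {n : ℕ} {ω : Fin n → A} {x : ℝ} (hx : x ∈ M.cylinder ω) {l : ℕ}
    (hl : l < n) : M.T' (M.T^[l] x) ≠ 0 :=
  T'_ne_zero (hx ⟨l, hl⟩)

theorem derivProd_pos {n : ℕ} {ω : Fin n → A} {x : ℝ} (hx : x ∈ M.cylinder ω) :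
    0 < M.derivProd n x :=
  Finset.prod_pos fun _ hl => abs_pos.2 (T'_iterate_ne_zero hx (Finset.mem_range.1 hl))

theorem hasDerivWithinAt_iterate {n : ℕ} (ω : Fin n → A) {x : ℝ} (hx : x ∈ M.cylinder ω) :
    HasDerivWithinAt M.T^[n] (∏ l ∈ Finset.range n, M.T' (M.T^[l] x)) (M.cylinder ω) x := by
  induction n with
  | zero => simpa using hasDerivWithinAt_id x _
  | succ n ih =>
    rw [mem_cylinder_succ] at hx
    have hT := M.T_hasDeriv _ _ hx.2
    have hn := (ih _ hx.1).mono fun y (hy : y ∈ M.cylinder ω) => (mem_cylinder_succ.1 hy).1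
    rw [Function.iterate_succ', Finset.prod_range_succ, mul_comm]
    exact hT.comp x hn fun y hy => (mem_cylinder_succ.1 hy).2

theorem continuousOn_iterate {n : ℕ} (ω : Fin n → A) : ContinuousOn M.T^[n] (M.cylinder ω) :=
  fun _ hx => (hasDerivWithinAt_iterate ω hx).continuousWithinAt

theorem exists_abs_iterate_sub_eq_of_lt {n : ℕ} {ω : Fin n → A} {x y : ℝ} (hxy : x < y)
    (h : Icc x y ⊆ M.cylinder ω) :
    ∃ z ∈ M.cylinder ω, |M.T^[n] x - M.T^[n] y| = M.derivProd n z * |x - y| := by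
  obtain ⟨z, hz, hd⟩ := exists_hasDerivAt_eq_slope M.T^[n]
    (fun z => ∏ l ∈ Finset.range n, M.T' (M.T^[l] z)) hxy ((continuousOn_iterate ω).mono h)
    fun z hz => (hasDerivWithinAt_iterate ω (h (Ioo_subset_Icc_self hz))).hasDerivAt
      (mem_of_superset (Icc_mem_nhds hz.1 hz.2) h)
  refine ⟨z, h (Ioo_subset_Icc_self hz), ?_⟩
  rw [derivProd, ← Finset.abs_prod, hd, abs_div, abs_sub_comm x y,
    div_mul_cancel₀ _ (abs_ne_zero.2 (sub_ne_zero.2 hxy.ne')), abs_sub_comm]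

theorem ordConnected_cylinder {n : ℕ} (ω : Fin n → A) : (M.cylinder ω).OrdConnected := by
  induction n with
  | zero =>
    have : M.cylinder ω = univ := eq_univ_of_forall fun x i => i.elim0
    rw [this]; exact ordConnected_univ
  | succ n ih =>
    refine ⟨fun x hx y hy z hz => ?_⟩
    rw [mem_cylinder_succ] at hx hy ⊢
    have hsub : Icc x y ⊆ M.cylinder fun i : Fin n => ω i.castSucc := (ih _).out hx.1 hy.1
    have hinj : InjOn M.T^[n] (Icc x y) := by
      have : ∀ u ∈ Icc x y, ∀ v ∈ Icc x y, u < v → M.T^[n] u ≠ M.T^[n] v := by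
        intro u hu v hv huv he
        obtain ⟨w, hw, he'⟩ := exists_abs_iterate_sub_eq_of_lt huv
          ((Icc_subset_Icc hu.1 hv.2).trans hsub)
        rw [he, sub_self, abs_zero] at he'
        have := mul_pos (derivProd_pos hw) (abs_pos.2 (sub_ne_zero.2 huv.ne))
        linarith
      intro u hu v hv he
      by_contra hne
      rcases lt_or_gt_of_ne hne with h | h
      · exact this u hu v hv h he
      · exact this v hv u hu h he.symm
    refine ⟨hsub hz, ?_⟩
    have hxy : x ≤ y := hz.1.trans hz.2
    have hx' : x ∈ Icc x y := left_mem_Icc.2 hxy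
    have hy' : y ∈ Icc x y := right_mem_Icc.2 hxy
    rcases ((continuousOn_iterate _).mono hsub).strictMonoOn_of_injOn_Icc' hxy hinj with h | h
    · exact (M.V_ordConnected _).out hx.2 hy.2
        ⟨h.monotoneOn hx' hz hz.1, h.monotoneOn hz hy' hz.2⟩
    · exact (M.V_ordConnected _).out hy.2 hx.2
        ⟨h.antitoneOn hz hy' hz.2, h.antitoneOn hx' hz hz.1⟩

theorem exists_abs_iterate_sub_eq {n : ℕ} {ω : Fin n → A} {x y : ℝ} (hx : x ∈ M.cylinder ω)
    (hy : y ∈ M.cylinder ω) :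
    ∃ z ∈ M.cylinder ω, |M.T^[n] x - M.T^[n] y| = M.derivProd n z * |x - y| := by
  rcases lt_trichotomy x y with h | rfl | h
  · exact exists_abs_iterate_sub_eq_of_lt h ((ordConnected_cylinder ω).out hx hy)
  · exact ⟨x, hx, by simp⟩
  · obtain ⟨z, hz, he⟩ := exists_abs_iterate_sub_eq_of_lt h ((ordConnected_cylinder ω).out hy hx)
    exact ⟨z, hz, by rw [abs_sub_comm, he, abs_sub_comm]⟩

theorem eq_of_mem_cylinder {n : ℕ} {ω τ : Fin n → A} {x : ℝ} (hω : x ∈ M.cylinder ω)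
    (hτ : x ∈ M.cylinder τ) : ω = τ := by
  funext i
  by_contra h
  exact Set.disjoint_left.1 (M.V_disjoint h) (hω i) (hτ i)

theorem lt_of_mem_cylinder {n : ℕ} {ω τ : Fin n → A} (hne : ω ≠ τ) {x x' y : ℝ}
    (hx : x ∈ M.cylinder ω) (hx' : x' ∈ M.cylinder ω) (hy : y ∈ M.cylinder τ) (h : x < y) :
    x' < y := by
  by_contra! h'
  exact hne (eq_of_mem_cylinder ((ordConnected_cylinder ω).out hx hx' ⟨h.le, h'⟩) hy)

theorem lt_of_mem_cylinder' {n : ℕ} {ω τ : Fin n → A} (hne : ω ≠ τ) {x x' y : ℝ}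
    (hx : x ∈ M.cylinder ω) (hx' : x' ∈ M.cylinder ω) (hy : y ∈ M.cylinder τ) (h : y < x) :
    y < x' := by
  by_contra! h'
  exact hne (eq_of_mem_cylinder ((ordConnected_cylinder ω).out hx' hx ⟨h', h.le⟩) hy)

theorem exists_iterate_eq {n : ℕ} (ω : Fin n → A) {z : ℝ} (hz : z ∈ Ioo (0 : ℝ) 1) :
    ∃ x ∈ M.cylinder ω, x ∈ Ioo (0 : ℝ) 1 ∧ M.T^[n] x = z := by
  induction n generalizing z with
  | zero => exact ⟨z, fun i => i.elim0, hz, rfl⟩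
  | succ n ih =>
    rw [← M.T_maps_interior (ω (Fin.last n))] at hz
    obtain ⟨w, hw, rfl⟩ := hz
    have hw' : w ∈ Ioo (0 : ℝ) 1 := by
      rw [← interior_Icc]
      exact interior_mono (M.V_subset _) hw
    obtain ⟨x, hx, hx01, rfl⟩ := ih (fun i : Fin n => ω i.castSucc) hw'
    exact ⟨x, mem_cylinder_succ.2 ⟨hx, interior_subset hw⟩, hx01,
      Function.iterate_succ_apply' _ _ _⟩

theorem abs_iterate_sub_le_one {n : ℕ} (hn : n ≠ 0) {ω : Fin n → A} {x y : ℝ}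
    (hx : x ∈ M.cylinder ω) (hy : y ∈ M.cylinder ω) : |M.T^[n] x - M.T^[n] y| ≤ 1 := by
  obtain ⟨n, rfl⟩ := Nat.exists_eq_succ_of_ne_zero hn
  rw [Nat.succ_eq_add_one, Function.iterate_succ_apply', Function.iterate_succ_apply']
  have h1 := M.T_mapsTo _ (mem_cylinder_succ.1 hx).2
  have h2 := M.T_mapsTo _ (mem_cylinder_succ.1 hy).2
  rw [abs_le]
  constructor <;> linarith [h1.1, h1.2, h2.1, h2.2]

theorem mem_repeller_of_iterate {n : ℕ} {ω : Fin n → A} {x : ℝ} (hx : x ∈ M.cylinder ω)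
    (h : M.T^[n] x ∈ M.repeller) : x ∈ M.repeller := by
  intro m
  rcases lt_or_ge m n with hm | hm
  · exact mem_iUnion.2 ⟨_, hx ⟨m, hm⟩⟩
  · obtain ⟨k, rfl⟩ := Nat.exists_eq_add_of_le hm
    have := h k
    rwa [← Function.iterate_add_apply, add_comm] at this

theorem exists_mem_cylinder {x : ℝ} (hx : x ∈ M.repeller) (n : ℕ) :
    ∃ ω : Fin n → A, x ∈ M.cylinder ω := by
  choose i hi using fun k => mem_iUnion.1 (hx k)
  exact ⟨fun k => i k, fun k => hi k⟩

end Cylinders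

section LimitSet

variable {A : Type} {M : ExpandingMarkovMap A}

theorem exists_pos_forall_le_dist {F X : Type*} [Finite F] [Nonempty F] [MetricSpace X]
    [CompactSpace X] [Nonempty X] {g : F → X → X} (hg : ∀ i, Continuous (g i))
    (hne : ∀ i j, i ≠ j → ∀ x y, g i x ≠ g j y) :
    ∃ θ : ℝ, 0 < θ ∧ ∀ i j, i ≠ j → ∀ x y, θ ≤ dist (g i x) (g j y) := by
  have : ∀ p : F × F, ∃ θ : ℝ, 0 < θ ∧ (p.1 ≠ p.2 → ∀ x y, θ ≤ dist (g p.1 x) (g p.2 y)) := by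
    rintro ⟨i, j⟩
    by_cases hij : i = j
    · exact ⟨1, one_pos, fun h => absurd hij h⟩
    have hcont : Continuous fun q : X × X => dist (g i q.1) (g j q.2) :=
      ((hg i).comp continuous_fst).dist ((hg j).comp continuous_snd)
    obtain ⟨q, -, hq⟩ := isCompact_univ.exists_isMinOn univ_nonempty hcont.continuousOn
    exact ⟨_, dist_pos.2 (hne i j hij q.1 q.2), fun _ x y => hq (mem_univ (x, y))⟩
  choose θ hθ hle using this
  have := Fintype.ofFinite F
  refine ⟨Finset.univ.inf' Finset.univ_nonempty θ, by simp [Finset.lt_inf'_iff, hθ], ?_⟩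
  exact fun i j hij x y => (Finset.inf'_le _ (Finset.mem_univ (i, j))).trans (hle (i, j) hij x y)

theorem _root_.Finset.sum_le_sum_erase_add_one {ι : Type*} [DecidableEq ι] {F : Finset ι}
    {f : ι → ℝ} (hf : ∀ i, f i ≤ 1) (a : ι) : ∑ i ∈ F, f i ≤ ∑ i ∈ F.erase a, f i + 1 := by
  by_cases ha : a ∈ F
  · rw [← Finset.sum_erase_add _ _ ha]
    gcongr
    exact hf a
  · rw [Finset.erase_eq_of_notMem ha]
    linarith

/-- A finite family of cylinders of the same length with large total weight carries a subset of
the repeller of large dimension: after discarding the leftmost and the rightmost cylinder, the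
remaining inverse branches preserve a compact subinterval of `(0,1)`. -/
theorem exists_subset_repeller_le_dimH {n : ℕ} (hn : n ≠ 0) {ξ : ℝ} (hξ : 1 < ξ)
    (hexp : ∀ ω : Fin n → A, ∀ x ∈ M.cylinder ω, ξ ≤ M.derivProd n x)
    (F : Finset (Fin n → A)) {D : (Fin n → A) → ℝ}
    (hD : ∀ ω : Fin n → A, ∀ x ∈ M.cylinder ω, M.derivProd n x ≤ D ω) {s : ℝ≥0}
    (hs : 3 ≤ ∑ ω ∈ F, (D ω)⁻¹ ^ (s : ℝ)) :
    ∃ E ⊆ M.repeller ∩ Ioo (0 : ℝ) 1, E.Nonempty ∧ (s : ℝ≥0∞) ≤ dimH E := by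
  classical
  have hξ0 : 0 < ξ := one_pos.trans hξ
  have hF : F.Nonempty := by
    rw [Finset.nonempty_iff_ne_empty]
    rintro rfl
    norm_num at hs
  choose! h hcyl h01 hT using fun (ω : Fin n → A) (z : ℝ) (hz : z ∈ Ioo (0 : ℝ) 1) =>
    exists_iterate_eq (M := M) ω hz
  have hhalf : (1 / 2 : ℝ) ∈ Ioo (0 : ℝ) 1 := by norm_num
  have hDξ (ω : Fin n → A) : ξ ≤ D ω :=
    (hexp ω _ (hcyl ω _ hhalf)).trans (hD ω _ (hcyl ω _ hhalf))
  have hD0 (ω : Fin n → A) : 0 < D ω := hξ0.trans_le (hDξ ω)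
  obtain ⟨L, hL, hLmin⟩ := F.exists_min_image (fun ω => h ω (1 / 2)) hF
  obtain ⟨R, hR, hRmax⟩ := F.exists_max_image (fun ω => h ω (1 / 2)) hF
  set a := h L (1 / 2) with ha
  set b := h R (1 / 2) with hb
  have hab : a ≤ b := hLmin R hR
  have hsub : Icc a b ⊆ Ioo (0 : ℝ) 1 := Icc_subset_Ioo (h01 L _ hhalf).1 (h01 R _ hhalf).2
  let F' := (F.erase L).erase R
  have hs' : 1 ≤ ∑ ω ∈ F', (D ω)⁻¹ ^ (s : ℝ) := by
    have hle (ω : Fin n → A) : (D ω)⁻¹ ^ (s : ℝ) ≤ 1 :=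
      Real.rpow_le_one (inv_nonneg.2 (hD0 ω).le) (inv_le_one_of_one_le₀ (hξ.le.trans (hDξ ω)))
        s.coe_nonneg
    have h1 := Finset.sum_le_sum_erase_add_one (F := F) hle L
    have h2 := Finset.sum_le_sum_erase_add_one (F := F.erase L) hle R
    linarith
  have hcylsub (ω : Fin n → A) (hω : ω ∈ F') : M.cylinder ω ⊆ Icc a b := by
    intro y hy
    obtain ⟨hωR, hω'⟩ := Finset.mem_erase.1 hω
    obtain ⟨hωL, hωF⟩ := Finset.mem_erase.1 hω'
    have hxω := hcyl ω _ hhalf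
    constructor
    · refine (lt_of_mem_cylinder' hωL hxω hy (hcyl L _ hhalf)
        (lt_of_le_of_ne (hLmin ω hωF) fun he => hωL ?_)).le
      exact eq_of_mem_cylinder hxω (he ▸ hcyl L _ hhalf)
    · refine (lt_of_mem_cylinder hωR hxω hy (hcyl R _ hhalf)
        (lt_of_le_of_ne (hRmax ω hωF) fun he => hωR ?_)).le
      exact eq_of_mem_cylinder hxω (he ▸ hcyl R _ hhalf)
  have : Nonempty F' := by
    rw [Finset.nonempty_coe_sort, Finset.nonempty_iff_ne_empty]
    intro he
    rw [he] at hs'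
    norm_num at hs'
  have : Nonempty (Icc a b) := ⟨⟨a, left_mem_Icc.2 hab⟩⟩
  let g : F' → Icc a b → Icc a b := fun i z =>
    ⟨h i z, hcylsub i i.2 (hcyl i z (hsub z.2))⟩
  have hgT (i : F') (z : Icc a b) : M.T^[n] (g i z) = z := hT i z (hsub z.2)
  have hgc (i : F') (z : Icc a b) : (g i z : ℝ) ∈ M.cylinder i.1 := hcyl i z (hsub z.2)
  have hdist (i : F') (z w : Icc a b) : ∃ ζ ∈ M.cylinder i.1,
      dist z w = M.derivProd n ζ * dist (g i z) (g i w) := by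
    obtain ⟨ζ, hζ, he⟩ := exists_abs_iterate_sub_eq (hgc i z) (hgc i w)
    refine ⟨ζ, hζ, ?_⟩
    rwa [hgT, hgT] at he
  let r : ℝ≥0 := ⟨ξ⁻¹, inv_nonneg.2 hξ0.le⟩
  have hr : r < 1 := by
    rw [← NNReal.coe_lt_coe]
    exact inv_lt_one_of_one_lt₀ hξ
  have hlip (i : F') : LipschitzWith r (g i) := by
    refine LipschitzWith.of_dist_le_mul fun z w => ?_
    obtain ⟨ζ, hζ, he⟩ := hdist i z w
    change _ ≤ ξ⁻¹ * _
    rw [inv_mul_eq_div, le_div_iff₀ hξ0, he, mul_comm]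
    exact mul_le_mul_of_nonneg_right (hexp _ ζ hζ) dist_nonneg
  have hlow (i : F') (z w : Icc a b) : (D i.1)⁻¹ * dist z w ≤ dist (g i z) (g i w) := by
    obtain ⟨ζ, hζ, he⟩ := hdist i z w
    rw [inv_mul_eq_div, div_le_iff₀ (hD0 _), he, mul_comm]
    exact mul_le_mul_of_nonneg_left (hD _ ζ hζ) dist_nonneg
  obtain ⟨θ, hθ, hsep⟩ := exists_pos_forall_le_dist (fun i => (hlip i).continuous)
    fun i j hij x y he => hij <| Subtype.ext <|
      eq_of_mem_cylinder (hgc i x) (by rw [he]; exact hgc j y)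
  let : TopologicalSpace F' := ⊥
  have : DiscreteTopology F' := ⟨rfl⟩
  obtain ⟨π, hπ⟩ := exists_codingMap g hr hlip
  have hdim := le_dimH_range_codingMap (c := fun i : F' => (D i.1)⁻¹) (r := ξ⁻¹)
    (inv_lt_one_of_one_lt₀ hξ) hθ (fun i => inv_pos.2 (hD0 _))
    (fun i => inv_anti₀ hξ0 (hDξ _)) hlow hsep π hπ (s := s)
    (by rwa [Finset.sum_coe_sort F' fun ω => (D ω)⁻¹ ^ (s : ℝ)])
  refine ⟨Subtype.val '' range π, ?_, (range_nonempty π).image _,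
    by rwa [isometry_subtype_coe.dimH_image]⟩
  rintro _ ⟨_, ⟨σ, rfl⟩, rfl⟩
  refine ⟨fun m => ?_, hsub (π σ).2⟩
  induction m using Nat.strong_induction_on generalizing σ with
  | _ m ih =>
    have hx : (π σ : ℝ) ∈ M.cylinder (σ 0).1 := by rw [hπ]; exact hgc _ _
    rcases lt_or_ge m n with hm | hm
    · exact mem_iUnion.2 ⟨_, hx ⟨m, hm⟩⟩
    · obtain ⟨k, rfl⟩ := Nat.exists_eq_add_of_le hm
      rw [add_comm, Function.iterate_add_apply, hπ, hgT]
      exact ih k (by omega) _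

end LimitSet

section Pressure

theorem inv_mul_log_lt_iff {n : ℕ} (hn : n ≠ 0) {a : ℝ} {Z : ℝ≥0∞} :
    ((1 / (n : ℝ) : ℝ) : EReal) * ENNReal.log Z < a ↔ Z < ENNReal.ofReal (Real.exp (n * a)) := by
  have hn0 : (0 : ℝ) < n := by positivity
  rw [← ENNReal.log_lt_log_iff, ENNReal.log_ofReal_of_pos (Real.exp_pos _), Real.log_exp]
  induction ENNReal.log Z with
  | bot => simp only [EReal.coe_mul_bot_of_pos (one_div_pos.2 hn0), EReal.bot_lt_coe]
  | top => simp [EReal.coe_mul_top_of_pos (inv_pos.2 hn0)]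
  | coe y =>
    rw [← EReal.coe_mul, EReal.coe_lt_coe_iff, EReal.coe_lt_coe_iff, one_div, inv_mul_lt_iff₀ hn0]

theorem lt_inv_mul_log_iff {n : ℕ} (hn : n ≠ 0) {a : ℝ} {Z : ℝ≥0∞} :
    (a : EReal) < ((1 / (n : ℝ) : ℝ) : EReal) * ENNReal.log Z ↔
      ENNReal.ofReal (Real.exp (n * a)) < Z := by
  have hn0 : (0 : ℝ) < n := by positivity
  rw [← ENNReal.log_lt_log_iff, ENNReal.log_ofReal_of_pos (Real.exp_pos _), Real.log_exp]
  induction ENNReal.log Z with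
  | bot => simp [EReal.coe_mul_bot_of_pos (inv_pos.2 hn0)]
  | top => simp only [EReal.coe_mul_top_of_pos (one_div_pos.2 hn0), EReal.coe_lt_top]
  | coe y =>
    rw [← EReal.coe_mul, EReal.coe_lt_coe_iff, EReal.coe_lt_coe_iff, one_div, lt_inv_mul_iff₀ hn0]

variable {A : Type} {M : ExpandingMarkovMap A}

theorem exists_log_expanding (M : ExpandingMarkovMap A) :
    ∃ κ > (0 : ℝ), ∀ᶠ n : ℕ in atTop, ∀ ω : Fin n → A, ∀ x ∈ M.cylinder ω,
      n * κ ≤ Real.log (M.derivProd n x) := by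
  obtain ⟨ξ, hξ, N, h⟩ := M.expanding
  refine ⟨Real.log ξ, Real.log_pos hξ, eventually_atTop.2 ⟨N, fun n hn ω x hx => ?_⟩⟩
  rw [← Real.log_pow]
  exact Real.log_le_log (by positivity) (h n hn ω x hx).le

theorem exists_log_distortion (M : ExpandingMarkovMap A) :
    ∃ e : ℕ → ℝ, Tendsto e atTop (𝓝 0) ∧ ∀ n, ∀ ω : Fin n → A, ∀ x ∈ M.cylinder ω,
      ∀ y ∈ M.cylinder ω,
        |Real.log (M.derivProd n x) - Real.log (M.derivProd n y)| ≤ n * e n := by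
  obtain ⟨ρ, hρ, h⟩ := M.distortion
  refine ⟨ρ, hρ, fun n ω x hx y hy => ?_⟩
  have hx0 := derivProd_pos hx
  have hy0 := derivProd_pos hy
  obtain ⟨h1, h2⟩ := h n ω x y hx hy
  rw [← Real.log_div hx0.ne' hy0.ne', abs_le]
  have hpos : 0 < M.derivProd n x / M.derivProd n y := div_pos hx0 hy0
  constructor
  · rw [← neg_mul]
    exact (Real.le_log_iff_exp_le hpos).2 h1
  · exact (Real.log_le_iff_le_exp hpos).2 h2

theorem birkhoff_neg_mul_psi {n : ℕ} {ω : Fin n → A} {x : ℝ} (hx : x ∈ M.cylinder ω) (s : ℝ) :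
    M.birkhoff (fun x => -s * M.psi x) n x = -s * Real.log (M.derivProd n x) := by
  rw [derivProd, Real.log_prod fun l hl =>
    abs_ne_zero.2 (T'_iterate_ne_zero hx (Finset.mem_range.1 hl)), Finset.mul_sum]
  rfl

theorem repeller_inter_Ioo_nonempty (M : ExpandingMarkovMap A) :
    (M.repeller ∩ Ioo (0 : ℝ) 1).Nonempty := by
  obtain ⟨κ, hκ, hexp⟩ := M.exists_log_expanding
  obtain ⟨e, -, he⟩ := M.exists_log_distortion
  obtain ⟨n, hn, hn2⟩ := (hexp.and (eventually_ge_atTop 2)).exists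
  obtain ⟨F, hF⟩ : ∃ F : Finset (Fin n → A), F.card = 3 := by
    obtain ⟨i, j, hij⟩ := M.nontriv
    let f : (Fin n → Fin 2) ↪ (Fin n → A) :=
      ⟨fun u k => ![i, j] (u k), fun u v huv => funext fun k => by
        have := congrFun huv k
        have hinj : Function.Injective ![i, j] := by
          intro p q hpq
          fin_cases p <;> fin_cases q <;> simp_all
        exact hinj this⟩
    obtain ⟨F, -, hF⟩ := Finset.exists_subset_card_eq (s := Finset.univ.map f) (n := 3) (by
      rw [Finset.card_map, Finset.card_univ, Fintype.card_fun, Fintype.card_fin, Fintype.card_fin]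
      calc 3 ≤ 2 ^ 2 := by norm_num
        _ ≤ 2 ^ n := Nat.pow_le_pow_right (by norm_num) hn2)
    exact ⟨F, hF⟩
  have hn0 : n ≠ 0 := by omega
  choose p hp using fun ω : Fin n → A =>
    (exists_iterate_eq (M := M) ω (z := 1 / 2) (by norm_num)).imp fun _ h => h.1
  obtain ⟨E, hE, hne, -⟩ := exists_subset_repeller_le_dimH (M := M) (s := 0) hn0
    (ξ := Real.exp (n * κ)) (Real.one_lt_exp_iff.2 (by positivity))
    (fun ω x hx => (Real.le_log_iff_exp_le (derivProd_pos hx)).1 (hn ω x hx)) F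
    (D := fun ω => Real.exp (Real.log (M.derivProd n (p ω)) + n * e n))
    (fun ω x hx => (Real.log_le_iff_le_exp (derivProd_pos hx)).1 (by
      linarith [(abs_le.1 (he n ω x hx _ (hp ω))).2]))
    (by simp [hF])
  exact hne.mono hE

theorem cylinder_inter_repeller_nonempty {n : ℕ} (ω : Fin n → A) :
    (M.cylinder ω ∩ M.repeller).Nonempty := by
  obtain ⟨z, hz, hz01⟩ := M.repeller_inter_Ioo_nonempty
  obtain ⟨x, hx, -, rfl⟩ := exists_iterate_eq (M := M) ω hz01
  exact ⟨x, hx, mem_repeller_of_iterate hx hz⟩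

theorem abs_birkhoffSup_add_le {e : ℕ → ℝ}
    (he : ∀ n, ∀ ω : Fin n → A, ∀ x ∈ M.cylinder ω, ∀ y ∈ M.cylinder ω,
      |Real.log (M.derivProd n x) - Real.log (M.derivProd n y)| ≤ n * e n)
    (s : ℝ) {n : ℕ} {ω : Fin n → A} {x : ℝ} (hx : x ∈ M.cylinder ω) :
    |M.birkhoffSup (fun x => -s * M.psi x) ω + s * Real.log (M.derivProd n x)| ≤
      |s| * (n * e n) := by
  have hv : ∀ v ∈ {v | ∃ y ∈ M.cylinder ω ∩ M.repeller,
      v = M.birkhoff (fun x => -s * M.psi x) n y},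
      |v + s * Real.log (M.derivProd n x)| ≤ |s| * (n * e n) := by
    rintro v ⟨y, hy, rfl⟩
    rw [birkhoff_neg_mul_psi hy.1, neg_mul, neg_add_eq_sub, ← mul_sub, abs_mul]
    exact mul_le_mul_of_nonneg_left (he n ω x hx y hy.1) (abs_nonneg s)
  have hupper : ∀ v ∈ {v | ∃ y ∈ M.cylinder ω ∩ M.repeller,
      v = M.birkhoff (fun x => -s * M.psi x) n y},
      v ≤ |s| * (n * e n) - s * Real.log (M.derivProd n x) := fun v h => by
    linarith [(abs_le.1 (hv v h)).2]
  obtain ⟨y, hy⟩ := cylinder_inter_repeller_nonempty (M := M) ω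
  have hmem : M.birkhoff (fun x => -s * M.psi x) n y ∈ {v | ∃ y ∈ M.cylinder ω ∩ M.repeller,
      v = M.birkhoff (fun x => -s * M.psi x) n y} := ⟨y, hy, rfl⟩
  rw [birkhoffSup, abs_le]
  constructor
  · linarith [(abs_le.1 (hv _ hmem)).1, le_csSup ⟨_, hupper⟩ hmem]
  · linarith [csSup_le ⟨_, hmem⟩ hupper]

theorem pressure_pos_of_neg {s : ℝ} (hs : s < 0) : 0 < M.pressure (fun x => -s * M.psi x) := by
  obtain ⟨κ, hκ, hexp⟩ := M.exists_log_expanding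
  obtain ⟨e, he0, he⟩ := M.exists_log_distortion
  have hpos : 0 < -s * κ := mul_pos (neg_pos.2 hs) hκ
  have hsmall : ∀ᶠ n in atTop, |s| * e n < -s * κ / 2 :=
    (by simpa using he0.const_mul |s| : Tendsto (fun n => |s| * e n) atTop (𝓝 0)).eventually_lt_const
      (by linarith)
  have hδ : ((0 : ℝ) : EReal) < ((-s * κ / 2 : ℝ) : EReal) :=
    EReal.coe_lt_coe_iff.2 (by linarith)
  refine hδ.trans_le (le_limsup_of_frequently_le' (Eventually.frequently ?_))
  filter_upwards [hexp, hsmall, eventually_ne_atTop 0] with n hn hns hn0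
  refine le_of_not_gt fun hlt => ?_
  rw [inv_mul_log_lt_iff hn0] at hlt
  obtain ⟨i, -⟩ := M.nontriv
  obtain ⟨x, hx, -⟩ := cylinder_inter_repeller_nonempty (M := M) fun _ : Fin n => i
  refine absurd ((ENNReal.le_tsum _).trans_lt hlt) (not_lt.2 (ENNReal.ofReal_le_ofReal
    (Real.exp_le_exp.2 (?_ : _ ≤ M.birkhoffSup _ fun _ : Fin n => i))))
  have h1 := (abs_le.1 (abs_birkhoffSup_add_le he s hx)).1
  have h2 := mul_le_mul_of_nonneg_left (hn _ x hx) (neg_nonneg.2 hs.le)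
  have h3 := mul_le_mul_of_nonneg_left hns.le n.cast_nonneg
  nlinarith

theorem dimH_repeller_le {s t : ℝ} (hst : s < t) (ht : 0 ≤ t)
    (hP : M.pressure (fun x => -s * M.psi x) ≤ 0) : dimH M.repeller ≤ ENNReal.ofReal t := by
  have := M.countable
  obtain ⟨κ, hκ, hexp⟩ := M.exists_log_expanding
  obtain ⟨e, he0, he⟩ := M.exists_log_distortion
  set ε := (t - s) * κ / 2 with hε
  have hε0 : 0 < ε := by have := mul_pos (sub_pos.2 hst) hκ; positivity
  have hsmall : ∀ᶠ n in atTop, (|s| + t) * e n < ε :=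
    (by simpa using he0.const_mul (|s| + t) :
      Tendsto (fun n => (|s| + t) * e n) atTop (𝓝 0)).eventually_lt_const hε0
  have hZ := eventually_lt_of_limsup_lt
    (hP.trans_lt (EReal.coe_lt_coe_iff.2 hε0 : ((0 : ℝ) : EReal) < (ε : EReal)))
  have hdiam : ∀ᶠ n : ℕ in atTop, ∀ ω : Fin n → A, ∀ ℓ : ℝ,
      (∀ x ∈ M.cylinder ω, ℓ ≤ Real.log (M.derivProd n x)) →
        Metric.ediam (M.cylinder ω) ≤ ENNReal.ofReal (Real.exp (-ℓ)) := by
    filter_upwards [eventually_ne_atTop 0] with n hn0 ω ℓ hℓ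
    refine Metric.ediam_le fun x hx y hy => ?_
    obtain ⟨z, hz, hxy⟩ := exists_abs_iterate_sub_eq hx hy
    rw [edist_dist, Real.dist_eq]
    refine ENNReal.ofReal_le_ofReal ?_
    have h1 := abs_iterate_sub_le_one hn0 hx hy
    rw [hxy, ← le_div_iff₀' (derivProd_pos hz)] at h1
    refine h1.trans ?_
    rw [one_div, Real.exp_neg]
    exact inv_anti₀ (Real.exp_pos _) ((Real.le_log_iff_exp_le (derivProd_pos hz)).1 (hℓ z hz))
  have hr : Tendsto (fun n : ℕ => ENNReal.ofReal (Real.exp (-(n * κ)))) atTop (𝓝 0) := by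
    rw [← ENNReal.ofReal_zero]
    exact ENNReal.tendsto_ofReal (Real.tendsto_exp_neg_atTop_nhds_zero.comp
      (tendsto_natCast_atTop_atTop.atTop_mul_const hκ))
  have hH := Measure.hausdorffMeasure_le_liminf_tsum t M.repeller _ hr
    (fun n (ω : Fin n → A) => M.cylinder ω)
    (by filter_upwards [hdiam, hexp] with n hn hn' ω using hn ω _ (hn' ω))
    (Eventually.of_forall fun n x hx => mem_iUnion.2 (exists_mem_cylinder hx n))
  have hle : ∀ᶠ n : ℕ in atTop,
      ∑' ω : Fin n → A, Metric.ediam (M.cylinder ω) ^ t ≤ (1 : ℝ≥0∞) := by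
    filter_upwards [hdiam, hexp, hsmall, hZ, eventually_ne_atTop 0] with n hd hx hs hz hn0
    rw [inv_mul_log_lt_iff hn0] at hz
    have hterm (ω : Fin n → A) : Metric.ediam (M.cylinder ω) ^ t ≤
        ENNReal.ofReal (Real.exp (M.birkhoffSup (fun x => -s * M.psi x) ω)) *
          ENNReal.ofReal (Real.exp (-(n * ε))) := by
      obtain ⟨w, hw, -⟩ := cylinder_inter_repeller_nonempty (M := M) ω
      have h1 := hd ω (Real.log (M.derivProd n w) - n * e n) fun x hx => by
        linarith [(abs_le.1 (he n ω x hx w hw)).1]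
      refine (ENNReal.rpow_le_rpow h1 ht).trans ?_
      rw [ENNReal.ofReal_rpow_of_pos (Real.exp_pos _), ← Real.exp_mul,
        ← ENNReal.ofReal_mul (Real.exp_pos _).le, ← Real.exp_add]
      refine ENNReal.ofReal_le_ofReal (Real.exp_le_exp.2 ?_)
      have h2 := (abs_le.1 (abs_birkhoffSup_add_le he s hw)).1
      have h3 := mul_le_mul_of_nonneg_left (hx ω w hw) (sub_pos.2 hst).le
      have h4 := mul_le_mul_of_nonneg_left hs.le n.cast_nonneg
      rw [hε] at h4 ⊢
      nlinarith
    calc ∑' ω : Fin n → A, Metric.ediam (M.cylinder ω) ^ t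
        ≤ (∑' ω : Fin n → A,
            ENNReal.ofReal (Real.exp (M.birkhoffSup (fun x => -s * M.psi x) ω))) *
          ENNReal.ofReal (Real.exp (-(n * ε))) := by
          rw [← ENNReal.tsum_mul_right]
          exact ENNReal.tsum_le_tsum hterm
      _ ≤ ENNReal.ofReal (Real.exp (n * ε)) * ENNReal.ofReal (Real.exp (-(n * ε))) := by gcongr
      _ = 1 := by
          rw [← ENNReal.ofReal_mul (Real.exp_pos _).le, ← Real.exp_add, add_neg_cancel,
            Real.exp_zero, ENNReal.ofReal_one]
  have hfin : μH[t] M.repeller ≤ 1 :=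
    hH.trans (liminf_le_of_frequently_le' hle.frequently)
  lift t to ℝ≥0 using ht
  rw [ENNReal.ofReal_coe_nnreal]
  exact dimH_le_of_hausdorffMeasure_ne_top (hfin.trans_lt ENNReal.one_lt_top).ne

theorem le_dimH_repeller {s : ℝ≥0} (hP : 0 < M.pressure (fun x => -(s : ℝ) * M.psi x)) :
    (s : ℝ≥0∞) ≤ dimH M.repeller := by
  obtain ⟨κ, hκ, hexp⟩ := M.exists_log_expanding
  obtain ⟨e, he0, he⟩ := M.exists_log_distortion
  obtain ⟨δ, hδ0, hδ⟩ := EReal.lt_iff_exists_real_btwn.1 hP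
  replace hδ0 : 0 < δ := EReal.coe_lt_coe_iff.1 hδ0
  have hfreq := frequently_lt_of_lt_limsup (by isBoundedDefault) hδ
  have hsmall : ∀ᶠ n in atTop, (2 * s) * e n < δ / 2 :=
    (by simpa using he0.const_mul (2 * (s : ℝ)) :
      Tendsto (fun n => 2 * (s : ℝ) * e n) atTop (𝓝 0)).eventually_lt_const (by linarith)
  have hbig : ∀ᶠ n : ℕ in atTop, (3 : ℝ) ≤ Real.exp (n * (δ / 2)) :=
    (Real.tendsto_exp_atTop.comp
      (tendsto_natCast_atTop_atTop.atTop_mul_const (by linarith))).eventually_ge_atTop 3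
  obtain ⟨n, hZ, hx, hs, h3, hn0⟩ :=
    (hfreq.and_eventually (hexp.and (hsmall.and (hbig.and (eventually_ne_atTop 0))))).exists
  rw [lt_inv_mul_log_iff hn0, ENNReal.tsum_eq_iSup_sum, lt_iSup_iff] at hZ
  obtain ⟨F, hF⟩ := hZ
  rw [← ENNReal.ofReal_sum_of_nonneg fun _ _ => (Real.exp_pos _).le,
    ENNReal.ofReal_lt_ofReal_iff_of_nonneg (Real.exp_pos _).le] at hF
  choose p hp using fun ω : Fin n → A => (cylinder_inter_repeller_nonempty (M := M) ω).left
  have hterm (ω : Fin n → A) :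
      Real.exp (-(n * (δ / 2))) * Real.exp (M.birkhoffSup (fun x => -(s : ℝ) * M.psi x) ω) ≤
        (Real.exp (Real.log (M.derivProd n (p ω)) + n * e n))⁻¹ ^ (s : ℝ) := by
    rw [← Real.exp_neg, ← Real.exp_mul, ← Real.exp_add, Real.exp_le_exp]
    have h1 := (abs_le.1 (abs_birkhoffSup_add_le he s (hp ω))).2
    have h2 := mul_le_mul_of_nonneg_left hs.le n.cast_nonneg
    rw [abs_of_nonneg s.coe_nonneg] at h1
    nlinarith
  obtain ⟨E, hE, -, hdim⟩ := exists_subset_repeller_le_dimH (M := M) (s := s) hn0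
    (ξ := Real.exp (n * κ)) (Real.one_lt_exp_iff.2 (by positivity))
    (fun ω x hx' => (Real.le_log_iff_exp_le (derivProd_pos hx')).1 (hx ω x hx')) F
    (D := fun ω => Real.exp (Real.log (M.derivProd n (p ω)) + n * e n))
    (fun ω x hx => (Real.log_le_iff_le_exp (derivProd_pos hx)).1 (by
      linarith [(abs_le.1 (he n ω x hx _ (hp ω))).2]))
    (by
      refine le_trans ?_ (Finset.sum_le_sum fun ω _ => hterm ω)
      rw [← Finset.mul_sum]
      calc (3 : ℝ) ≤ Real.exp (n * (δ / 2)) := h3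
        _ = Real.exp (-(n * (δ / 2))) * Real.exp (n * δ) := by
          rw [← Real.exp_add]; congr 1; ring
        _ ≤ _ := by gcongr)
  exact hdim.trans (dimH_mono fun x hx => (hE hx).1)

end Pressure

end ExpandingMarkovMap

/-- **Bowen's equation** (Mauldin–Urbański): the Hausdorff dimension of the repeller of an
expanding Markov map equals `inf { s : P(-sψ) ≤ 0 }` where `ψ = log |T'|`. -/
theorem dimH_repeller_eq {A : Type} (M : ExpandingMarkovMap A) :
    dimH M.repeller =
      ENNReal.ofReal (sInf {s : ℝ | M.pressure (fun x => -s * M.psi x) ≤ 0}) := by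
  set S := {s : ℝ | M.pressure (fun x => -s * M.psi x) ≤ 0} with hS
  have hnonneg : ∀ s ∈ S, 0 ≤ s := fun s hs => by
    by_contra! h
    exact absurd hs (not_le.2 (ExpandingMarkovMap.pressure_pos_of_neg h))
  have hlower (s : ℝ≥0) (hs : (s : ℝ) ∉ S) : (s : ℝ≥0∞) ≤ dimH M.repeller :=
    ExpandingMarkovMap.le_dimH_repeller (not_le.1 hs)
  have hne : S.Nonempty := by
    refine ⟨((2 : ℝ≥0) : ℝ), ?_⟩
    by_contra h
    have := (hlower 2 h).trans ((dimH_mono (subset_univ _)).trans_eq Real.dimH_univ)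
    norm_num at this
  apply le_antisymm
  · refine ENNReal.le_of_forall_pos_le_add fun ε hε _ => ?_
    obtain ⟨s, hs, hlt⟩ := exists_lt_of_csInf_lt hne
      (lt_add_of_pos_right (sInf S) (NNReal.coe_pos.2 hε))
    refine (ExpandingMarkovMap.dimH_repeller_le hlt ((hnonneg s hs).trans hlt.le) hs).trans ?_
    exact ENNReal.ofReal_add_le.trans_eq (by rw [ENNReal.ofReal_coe_nnreal])
  · refine le_of_forall_lt_imp_le_of_dense fun a ha => ?_
    lift a to ℝ≥0 using ha.ne_top
    refine hlower a fun hmem => ?_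
    rw [ENNReal.lt_ofReal_iff_toReal_lt ENNReal.coe_ne_top] at ha
    exact absurd ha (not_lt.2 (csInf_le ⟨0, hnonneg⟩ hmem))
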